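/- Suppose that A and B are subgroups of a 4-free group Γ. Suppose that localrank(A) = localrank(B) = 2 and that the subgroup A ∩ B is non-abelian. Then localrank(⟨A, B⟩) = 2. -/

import Mathlib

/-- The rank of a subgroup, as an extended natural number: the minimal cardinality of a
finite generating set, or `⊤` if the subgroup is not finitely generated. -/
noncomputable def subgroupRank {Γ : Type*} [Group Γ] (H : Subgroup Γ) : ℕ∞ :=
  ⨅ (S : Finset Γ) (_ : Subgroup.closure (S : Set Γ) = H), (S.card : ℕ∞)

/-- `A` has local rank at most `r` if every finitely generated subgroup of `A` is contained
in a subgroup of `A` of rank at most `r`. -/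
def LocalRankLE {Γ : Type*} [Group Γ] (A : Subgroup Γ) (r : ℕ) : Prop :=
  ∀ B : Subgroup Γ, B ≤ A → B.FG →
    ∃ C : Subgroup Γ, C ≤ A ∧ B ≤ C ∧ subgroupRank C ≤ (r : ℕ∞)

/-- The local rank of a subgroup: the least `r` such that `LocalRankLE A r`, or `⊤` if
there is no such `r`. -/
noncomputable def localRank {Γ : Type*} [Group Γ] (A : Subgroup Γ) : ℕ∞ :=
  ⨅ (r : ℕ) (_ : LocalRankLE A r), (r : ℕ∞)

/-- A group is `k`-free if every subgroup of rank at most `k` is free. -/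
def KFree (Γ : Type*) [Group Γ] (k : ℕ) : Prop :=
  ∀ H : Subgroup Γ, subgroupRank H ≤ (k : ℕ∞) → IsFreeGroup H

/-- The index of freedom of `Γ`: the supremum of all `k` such that `Γ` is `k`-free. -/
noncomputable def iof (Γ : Type*) [Group Γ] : ℕ∞ :=
  ⨆ (k : ℕ) (_ : KFree Γ k), (k : ℕ∞)

/-- A subgroup `A` of `Γ` is strongly closable if `localRank A < iof Γ`. -/
def StronglyClosable {Γ : Type*} [Group Γ] (A : Subgroup Γ) : Prop :=
  localRank A < iof Γ

/-- A subgroup `A` of `Γ` is closable if it has finite local rank and there is some `z ∈ Γ`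
with `localRank ⟨A, z⟩ < iof Γ`. -/
def Closable {Γ : Type*} [Group Γ] (A : Subgroup Γ) : Prop :=
  localRank A < ⊤ ∧ ∃ z : Γ, localRank (A ⊔ Subgroup.closure {z}) < iof Γ

/-- An element `x` of `Γ` is `A`-admissible if `⟨A, x⟩` is strongly closable and
`localRank ⟨A, x⟩ ≤ localRank A`. -/
def Admissible {Γ : Type*} [Group Γ] (A : Subgroup Γ) (x : Γ) : Prop :=
  StronglyClosable (A ⊔ Subgroup.closure {x}) ∧
    localRank (A ⊔ Subgroup.closure {x}) ≤ localRank A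

/-- A sequence `x₁, …, x_m` is `A`-admissible if each `x_i` is `⟨A, x₁, …, x_{i-1}⟩`-admissible. -/
def AdmissibleSeq {Γ : Type*} [Group Γ] : Subgroup Γ → List Γ → Prop
  | _, [] => True
  | A, x :: xs => Admissible A x ∧ AdmissibleSeq (A ⊔ Subgroup.closure {x}) xs

/-- `clo A` is the set of all `x ∈ Γ` which occur as the last term of an `A`-admissible
sequence. -/
def clo {Γ : Type*} [Group Γ] (A : Subgroup Γ) : Set Γ :=
  { x | ∃ l : List Γ, AdmissibleSeq A (l ++ [x]) }

/-- The homomorphism `ι_{A,x}` from the free product `A ∗ ⟨t⟩` to `Γ` restricting to the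
inclusion on `A` and sending `t` to `x`. -/
noncomputable def iotaAX {Γ : Type*} [Group Γ] (A : Subgroup Γ) (x : Γ) :
    Monoid.Coprod (↥A) (Multiplicative ℤ) →* Γ :=
  Monoid.Coprod.lift A.subtype (zpowersHom Γ x)

/-- Elements `g 0, …, g (m-1)` of `Γ` are independent if they freely generate a free subgroup,
i.e. the induced homomorphism from the free group on `m` generators is injective. -/
def Independent {Γ : Type*} [Group Γ] {m : ℕ} (g : Fin m → Γ) : Prop :=
  Function.Injective (FreeGroup.lift g : FreeGroup (Fin m) →* Γ)


namespace JoinRank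

open FreeGroup in
theorem letter_mul {X : Type*} [DecidableEq X] (l : X × Bool) (g : FreeGroup X) :
    (toWord (mk [l] * g) = l :: toWord g ∧ (toWord g).head? ≠ some (l.1, !l.2)) ∨
      (FreeGroup.norm (mk [l] * g) + 1 = FreeGroup.norm g ∧ (toWord g).head? = some (l.1, !l.2)) := by
  have h : toWord (mk [l] * g) = reduce (l :: toWord g) := by
    rw [toWord_mul, toWord_mk, reduce_singleton]; rfl
  have h2 := reduce_toWord g
  unfold FreeGroup.norm
  rw [h, reduce.cons, h2]
  cases hw : toWord g with
  | nil => left; simp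
  | cons hd tl =>
    obtain ⟨l1, l2⟩ := l
    obtain ⟨h1, h2⟩ := hd
    simp only [List.head?_cons, Option.some.injEq, Prod.mk.injEq, ne_eq]
    by_cases hc : l1 = h1 ∧ l2 = !h2
    · right
      rw [if_pos hc]
      obtain ⟨rfl, rfl⟩ := hc
      simp
    · left
      rw [if_neg hc]
      refine ⟨rfl, ?_⟩
      rintro ⟨rfl, rfl⟩
      simp at hc

open FreeGroup in
theorem letter_norm {X : Type*} [DecidableEq X] (l : X × Bool) (g : FreeGroup X) :
    (FreeGroup.norm (mk [l] * g) = FreeGroup.norm g + 1) ∨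
      (FreeGroup.norm (mk [l] * g) + 1 = FreeGroup.norm g ∧ (toWord g).head? = some (l.1, !l.2)) := by
  rcases letter_mul l g with h | h
  · left; unfold FreeGroup.norm; rw [h.1]; rfl
  · right; exact h

open FreeGroup in
theorem tree_lemma {X : Type*} (Bad : Set (X × FreeGroup X)) (hfin : Bad.Finite)
    (h1 : ∀ e ∈ Bad, ∀ g, (g = e.2 ∨ g = (of e.1)⁻¹ * e.2) →
      ∃ e' ∈ Bad, e' ≠ e ∧ (g = e'.2 ∨ g = (of e'.1)⁻¹ * e'.2)) : Bad = ∅ := by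
  classical
  by_contra hne
  obtain ⟨e, he, hmax⟩ := hfin.exists_maximalFor
    (fun e : X × FreeGroup X => FreeGroup.norm e.2 + FreeGroup.norm ((of e.1)⁻¹ * e.2)) Bad (Set.nonempty_iff_ne_empty.2 hne)
  have hmax' : ∀ e' ∈ Bad, FreeGroup.norm e'.2 + FreeGroup.norm ((of e'.1)⁻¹ * e'.2) ≤
      FreeGroup.norm e.2 + FreeGroup.norm ((of e.1)⁻¹ * e.2) := by
    intro e' he'
    rcases le_total (FreeGroup.norm e'.2 + FreeGroup.norm ((of e'.1)⁻¹ * e'.2))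
      (FreeGroup.norm e.2 + FreeGroup.norm ((of e.1)⁻¹ * e.2)) with h | h
    · exact h
    · exact hmax he' h
  clear hmax
  obtain ⟨i, h⟩ := e
  have inv (j : X) : (of j)⁻¹ = mk [(j, false)] := rfl
  have pos (j : X) : of j = mk [(j, true)] := rfl
  simp only at hmax'
  rcases letter_norm (i, false) h with hn | hn
  · -- leaf is x⁻¹ h
    rw [← inv] at hn
    obtain ⟨⟨j, h'⟩, hb, hne', hg⟩ := h1 _ he _ (Or.inr rfl)
    simp only at hg
    set g := (of i)⁻¹ * h with hgdef
    have hh : h = of i * g := by simp [hgdef]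
    have k1 := letter_norm (i, true) g
    rw [← pos, ← hh] at k1
    have k2 := hmax' _ hb
    simp only at k2
    rcases hg with hg | hg
    · rw [← hg] at k2
      have k3 := letter_norm (j, false) g
      rw [← inv] at k3
      rcases k3 with k3 | k3
      · omega
      rcases k1 with k1 | k1
      · omega
      have := k3.2.symm.trans k1.2
      simp at this
    · rw [← hg] at k2
      have hh' : h' = of j * g := by simp [hg]
      have k3 := letter_norm (j, true) g
      rw [← pos, ← hh'] at k3
      rcases k3 with k3 | k3
      · omega
      rcases k1 with k1 | k1
      · omega
      have := k3.2.symm.trans k1.2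
      simp at this
      subst this
      exact hne' (by rw [hh, hh'])
  · rw [← inv] at hn
    obtain ⟨⟨j, h'⟩, hb, hne', hg⟩ := h1 _ he _ (Or.inl rfl)
    simp only at hg
    have k2 := hmax' _ hb
    simp only at k2
    rcases hg with hg | hg
    · subst hg
      have k3 := letter_norm (j, false) h
      rw [← inv] at k3
      rcases k3 with k3 | k3
      · omega
      have := k3.2.symm.trans hn.2
      simp at this
      subst this
      exact hne' rfl
    · rw [← hg] at k2
      have hh' : h' = of j * h := by simp [hg]
      have k3 := letter_norm (j, true) h
      rw [← pos, ← hh'] at k3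
      rcases k3 with k3 | k3
      · omega
      have := k3.2.symm.trans hn.2
      simp at this

open FreeGroup in
theorem central_free {Y : Type*} (z : FreeGroup Y) (hz : z ≠ 1) (hc : ∀ g, g * z = z * g)
    (i j : Y) : i = j := by
  classical
  have key : ∀ i : Y, ∃ b, (toWord z).head? = some (i, b) := by
    intro i
    rcases letter_mul (i, true) z with h | h
    · have h2 := toWord_mul_sublist z (mk [(i, true)])
      rw [← hc, h.1, toWord_mk, reduce_singleton] at h2
      have h3 := h2.eq_of_length (by simp)
      cases hw : toWord z with
      | nil => exact absurd (toWord_eq_nil_iff.1 hw) hz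
      | cons a t =>
        rw [hw] at h3
        simp at h3
        exact ⟨true, by simp [← h3.1]⟩
    · exact ⟨_, h.2⟩
  obtain ⟨b, hb⟩ := key i
  obtain ⟨b', hb'⟩ := key j
  have := hb.symm.trans hb'
  simp at this
  exact this.1

theorem free_comm_trans {X : Type*} (f x y : FreeGroup X) (hf : f ≠ 1)
    (hx : x * f = f * x) (hy : y * f = f * y) : x * y = y * x := by
  let C := Subgroup.centralizer {f}
  have mem : ∀ g, g ∈ C ↔ g * f = f * g := by
    intro g
    simp [C, Subgroup.mem_centralizer_singleton_iff]
  let e := IsFreeGroup.toFreeGroup C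
  have hfC : f ∈ C := (mem f).2 rfl
  have hsub : ∀ i j : IsFreeGroup.Generators C, i = j := by
    apply central_free (e ⟨f, hfC⟩)
    · intro h
      have : (⟨f, hfC⟩ : C) = 1 := e.injective (by rw [h, map_one])
      exact hf (congrArg Subtype.val this)
    · intro g
      obtain ⟨g, rfl⟩ := e.surjective g
      rw [← map_mul, ← map_mul]
      congr 1
      ext
      exact (mem g).1 g.2
  have hcomm : ∀ u v : FreeGroup (IsFreeGroup.Generators C), u * v = v * u := by
    haveI : Subsingleton (IsFreeGroup.Generators C) := ⟨hsub⟩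
    rcases isEmpty_or_nonempty (IsFreeGroup.Generators C) with h | h
    · intro u v; exact Subsingleton.elim _ _
    · haveI : Unique (IsFreeGroup.Generators C) := uniqueOfSubsingleton h.some
      intro u v
      have e2 := FreeGroup.mulEquivIntOfUnique (α := IsFreeGroup.Generators C)
      apply e2.injective
      rw [map_mul, map_mul, mul_comm]
  have := e.injective (by rw [map_mul, map_mul, hcomm] :
    e (⟨x, (mem x).2 hx⟩ * ⟨y, (mem y).2 hy⟩) = e (⟨y, (mem y).2 hy⟩ * ⟨x, (mem x).2 hx⟩))
  exact congrArg Subtype.val this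

theorem exists_hom {X : Type*} (C : Subgroup (FreeGroup X)) (hC : C ≠ ⊥) :
    ∃ φ : C →* Multiplicative ℤ, φ ≠ 1 := by
  refine ⟨IsFreeGroup.lift (fun _ => Multiplicative.ofAdd 1), ?_⟩
  intro h
  have hne : Nonempty (IsFreeGroup.Generators C) := by
    by_contra hempty
    rw [not_nonempty_iff] at hempty
    apply hC
    rw [eq_bot_iff]
    intro g hg
    have : IsFreeGroup.toFreeGroup C ⟨g, hg⟩ = IsFreeGroup.toFreeGroup C 1 :=
      Subsingleton.elim _ _
    have := (IsFreeGroup.toFreeGroup C).injective this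
    exact congrArg Subtype.val this
  obtain ⟨i⟩ := hne
  have h2 := IsFreeGroup.lift_of (fun _ : IsFreeGroup.Generators C => Multiplicative.ofAdd (1:ℤ)) i
  rw [h] at h2
  simp at h2
  exact absurd h2 (by decide)

instance free_uniqueProds {X : Type*} : UniqueProds (FreeGroup X) where
  uniqueMul_of_nonempty := by
    classical
    intro A B
    induction hn : A.card + B.card using Nat.strong_induction_on generalizing A B with
    | _ n ih =>
    subst hn
    intro hA hB
    by_cases hcard : A.card ≤ 1 ∧ B.card ≤ 1
    · exact UniqueMul.of_card_le_one hA hB hcard.1 hcard.2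
    obtain ⟨a, ha⟩ := id hA
    obtain ⟨b, hb⟩ := id hB
    let S : Set (FreeGroup X) := (fun g => a⁻¹ * g) '' A ∪ (fun g => g * b⁻¹) '' B
    let C := Subgroup.closure S
    have hSA : ∀ g ∈ A, a⁻¹ * g ∈ C := fun g hg =>
      Subgroup.subset_closure (Or.inl ⟨g, hg, rfl⟩)
    have hSB : ∀ g ∈ B, g * b⁻¹ ∈ C := fun g hg =>
      Subgroup.subset_closure (Or.inr ⟨g, hg, rfl⟩)
    have hC : C ≠ ⊥ := by
      intro h
      apply hcard
      constructor
      · rw [Finset.card_le_one]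
        have k : ∀ g ∈ A, g = a := by
          intro g hg
          have := hSA g hg
          rw [h, Subgroup.mem_bot] at this
          exact (inv_mul_eq_one.1 this).symm
        intro x hx y hy; rw [k x hx, k y hy]
      · rw [Finset.card_le_one]
        have k : ∀ g ∈ B, g = b := by
          intro g hg
          have := hSB g hg
          rw [h, Subgroup.mem_bot] at this
          exact (mul_inv_eq_one.1 this)
        intro x hx y hy; rw [k x hx, k y hy]
    obtain ⟨φ, hφ⟩ := exists_hom C hC
    let ψ : FreeGroup X → ℤ := fun g => if h : g ∈ C then (φ ⟨g, h⟩).toAdd else 0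
    have ψmul : ∀ g ∈ C, ∀ h ∈ C, ψ (g * h) = ψ g + ψ h := by
      intro g hg h hh
      simp only [ψ, dif_pos hg, dif_pos hh, dif_pos (mul_mem hg hh)]
      rw [← toAdd_mul, ← map_mul]; rfl
    have ψ1 : ψ 1 = 0 := by
      have := ψmul 1 (one_mem _) 1 (one_mem _)
      simpa using this
    obtain ⟨a1, ha1, hmina⟩ := A.exists_min_image (fun g => ψ (a⁻¹ * g)) hA
    obtain ⟨b1, hb1, hminb⟩ := B.exists_min_image (fun g => ψ (g * b⁻¹)) hB
    let A0 := A.filter (fun g => ψ (a⁻¹ * g) = ψ (a⁻¹ * a1))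
    let B0 := B.filter (fun g => ψ (g * b⁻¹) = ψ (b1 * b⁻¹))
    have hA0 : A0.Nonempty := ⟨a1, by simp [A0, ha1]⟩
    have hB0 : B0.Nonempty := ⟨b1, by simp [B0, hb1]⟩
    have lt : A0.card + B0.card < A.card + B.card := by
      have l1 : A0.card ≤ A.card := Finset.card_filter_le _ _
      have l2 : B0.card ≤ B.card := Finset.card_filter_le _ _
      by_contra hlt
      have e1 : A0 = A := Finset.eq_of_subset_of_card_le (Finset.filter_subset _ _) (by omega)
      have e2 : B0 = B := Finset.eq_of_subset_of_card_le (Finset.filter_subset _ _) (by omega)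
      have m1 : ∀ g ∈ A, ψ (a⁻¹ * g) = ψ (a⁻¹ * a1) := by
        intro g hg; rw [← e1] at hg; exact (Finset.mem_filter.1 hg).2
      have m2 : ∀ g ∈ B, ψ (g * b⁻¹) = ψ (b1 * b⁻¹) := by
        intro g hg; rw [← e2] at hg; exact (Finset.mem_filter.1 hg).2
      have z1 := m1 a ha
      have z2 := m2 b hb
      rw [inv_mul_cancel, ψ1] at z1
      rw [mul_inv_cancel, ψ1] at z2
      apply hφ
      have hker : ∀ g (hg : g ∈ C), φ ⟨g, hg⟩ = 1 := by
        intro g hg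
        induction hg using Subgroup.closure_induction with
        | mem x hx =>
          have : ψ x = 0 := by
            rcases hx with ⟨g, hg, rfl⟩ | ⟨g, hg, rfl⟩
            · exact (m1 g hg).trans z1.symm
            · exact (m2 g hg).trans z2.symm
          have hxC : x ∈ C := Subgroup.subset_closure hx
          simp only [ψ, dif_pos hxC] at this
          exact this
        | one => exact map_one φ
        | mul x y hx hy h1 h2 =>
          have := map_mul φ ⟨x, hx⟩ ⟨y, hy⟩
          rw [h1, h2, one_mul] at this
          exact this
        | inv x hx h1 =>
          have := map_inv φ ⟨x, hx⟩
          rw [h1, inv_one] at this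
          exact this
      ext ⟨g, hg⟩
      rw [hker g hg]; rfl
    obtain ⟨a0, ha0, b0, hb0, hu⟩ := ih _ lt rfl hA0 hB0
    have ha0' := Finset.mem_filter.1 ha0
    have hb0' := Finset.mem_filter.1 hb0
    refine ⟨a0, ha0'.1, b0, hb0'.1, ?_⟩
    intro g h hg hh he
    have e1 : (a⁻¹ * g) * (h * b⁻¹) = (a⁻¹ * a0) * (b0 * b⁻¹) := by
      calc _ = a⁻¹ * (g * h) * b⁻¹ := by group
        _ = _ := by rw [he]; group
    have e2 := congrArg ψ e1
    rw [ψmul _ (hSA g hg) _ (hSB h hh), ψmul _ (hSA a0 ha0'.1) _ (hSB b0 hb0'.1)] at e2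
    have m1 := hmina g hg
    have m2 := hminb h hh
    have m3 := ha0'.2
    have m4 := hb0'.2
    exact hu (Finset.mem_filter.2 ⟨hg, by omega⟩) (Finset.mem_filter.2 ⟨hh, by omega⟩) he

open MonoidAlgebra in
theorem unit_trivial {k : Type*} [Field k] {X : Type*} (u v : MonoidAlgebra k (FreeGroup X))
    (huv : u * v = 1) : ∃ g c, u = single g c := by
  classical
  have hu : u ≠ 0 := by rintro rfl; simp at huv
  have hv : v ≠ 0 := by rintro rfl; simp at huv
  haveI : TwoUniqueProds (FreeGroup X) := UniqueProds.toTwoUniqueProds_of_group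
  have c1 : 0 < u.coeff.support.card := by
    rw [Finset.card_pos, Finsupp.support_nonempty_iff]; simpa using hu
  have c2 : 0 < v.coeff.support.card := by
    rw [Finset.card_pos, Finsupp.support_nonempty_iff]; simpa using hv
  by_cases h : 1 < u.coeff.support.card * v.coeff.support.card
  · exfalso
    obtain ⟨p1, hp1, p2, hp2, hne, hu1, hu2⟩ := TwoUniqueProds.uniqueMul_of_one_lt_card h
    have key : ∀ p ∈ u.coeff.support ×ˢ v.coeff.support,
        UniqueMul u.coeff.support v.coeff.support p.1 p.2 → p.1 * p.2 = 1 := by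
      intro p hp hup
      have h1 := coeff_mul_mul_of_uniqueMul hup
      rw [Finset.mem_product, Finsupp.mem_support_iff, Finsupp.mem_support_iff] at hp
      have h2 := mul_ne_zero hp.1 hp.2
      rw [← h1, huv, one_def, coeff_single] at h2
      by_contra hcon
      exact h2 (Finsupp.single_eq_of_ne hcon)
    have k1 := key _ hp1 hu1
    have k2 := key _ hp2 hu2
    rw [Finset.mem_product] at hp1
    have := hu2 hp1.1 hp1.2 (k1.trans k2.symm)
    exact hne (Prod.ext this.1 this.2)
  · have : u.coeff.support.card = 1 := by nlinarith
    obtain ⟨g, c, -, hg⟩ := Finsupp.card_support_eq_one'.1 this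
    exact ⟨g, c, by rw [← coeff_inj, hg, coeff_single]⟩

end JoinRank


namespace JoinRank
section abs
set_option linter.unusedSectionVars false
variable {k : Type*} [Field k] {G : Type*} [Group G] {E V : Type*} [AddCommGroup E] [Module k E]
  [AddCommGroup V] [Module k V]

/-- finsupps with values in W -/
def vals (W : Submodule k V) : Submodule k (G →₀ V) where
  carrier := {z | ∀ g, z g ∈ W}
  add_mem' := fun ha hb g => W.add_mem (ha g) (hb g)
  zero_mem' := fun _ => W.zero_mem
  smul_mem' := fun c _ hx g => W.smul_mem c (hx g)

theorem mem_vals {W : Submodule k V} {z : G →₀ V} : z ∈ vals W ↔ ∀ g, z g ∈ W := Iff.rfl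

theorem single_mem_vals {W : Submodule k V} {h : G} {v : V} (hv : v ∈ W) :
    Finsupp.single h v ∈ vals (G := G) W := by
  classical
  intro g
  rw [Finsupp.single_apply]
  split_ifs
  · exact hv
  · exact W.zero_mem

theorem vals_le {W : Submodule k V} {P : Submodule k (G →₀ V)}
    (h : ∀ g, ∀ v ∈ W, Finsupp.single g v ∈ P) : vals W ≤ P := by
  intro z hz
  rw [← Finsupp.sum_single z]
  exact Submodule.sum_mem _ fun g _ => h g _ (hz g)

/-- right translation -/
noncomputable def tr (k : Type*) [Field k] {E : Type*} [AddCommGroup E] [Module k E] (g : G) :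
    (G →₀ E) →ₗ[k] (G →₀ E) := Finsupp.lmapDomain E k (· * g)

@[simp] theorem tr_single (g h : G) (e : E) :
    tr k g (Finsupp.single h e) = Finsupp.single (h * g) e := by
  simp [tr]

theorem tr_vals {W : Submodule k V} {z : G →₀ V} (g : G) (hz : z ∈ vals W) :
    tr k g z ∈ vals W := by
  have : vals W ≤ (vals W).comap (tr k (E := V) g) := by
    apply vals_le
    intro h v hv
    simp only [Submodule.mem_comap, tr_single]
    exact single_mem_vals hv
  exact this hz

/-- sum of values -/
noncomputable def eps (k : Type*) [Field k] {E : Type*} [AddCommGroup E] [Module k E] :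
    (G →₀ E) →ₗ[k] E := Finsupp.lsum k (fun _ => LinearMap.id)

@[simp] theorem eps_single (h : G) (e : E) : eps k (Finsupp.single h e) = e := by
  simp [eps]

theorem eps_vals {W : Submodule k V} {z : G →₀ V} (hz : z ∈ vals W) : eps k z ∈ W := by
  have : vals W ≤ W.comap (eps k (G := G) (E := V)) := by
    apply vals_le
    intro h v hv
    simpa using hv
  exact this hz

theorem abs_lemma [FiniteDimensional k E] (d : (G →₀ E) →ₗ[k] (G →₀ V))
    (hd : ∀ g z, d (tr k g z) = tr k g (d z))
    (H : ∀ (N : Submodule k E) (W : Submodule k V),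
      (∀ n ∈ N, d (Finsupp.single 1 n) ∈ vals W) →
      ((vals W).comap d ≤ vals N) ∨
        ∃ e, e ∉ N ∧ ∃ v γ, d (Finsupp.single 1 e) - Finsupp.single γ v ∈ vals W)
    (N : Submodule k E) : ∀ (W : Submodule k V),
      (∀ n ∈ N, d (Finsupp.single 1 n) ∈ vals W) →
      ∃ T : Submodule k (G →₀ E), T ≤ (vals W).comap d ∧ (∀ τ ∈ T, eps k τ ∈ N → τ = 0) ∧
        (vals W).comap d ≤ Submodule.span k {z | ∃ g, ∃ τ ∈ T, z = tr k g τ} ⊔ vals N := by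
  induction N using WellFoundedGT.induction with
  | _ N ih =>
  intro W hNW
  rcases H N W hNW with h | ⟨e, heN, v, γ, hev⟩
  · exact ⟨⊥, bot_le, by simp, h.trans le_sup_right⟩
  have hs : ∀ h e, d (Finsupp.single h e) = tr k h (d (Finsupp.single 1 e)) := by
    intro h e
    rw [← hd, tr_single, one_mul]
  have hlt : N < N ⊔ Submodule.span k {e} := by
    rw [lt_iff_le_and_ne]
    refine ⟨le_sup_left, ?_⟩
    intro h
    exact heN (h ▸ Submodule.mem_sup_right (Submodule.mem_span_singleton_self e))
  have hcN : ∀ c : k, c • e ∈ N → c = 0 := by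
    intro c hc
    by_contra h0
    exact heN ((N.smul_mem_iff h0).1 hc)
  have hmemN' : ∀ c : k, c • e ∈ N ⊔ Submodule.span k {e} := fun c =>
    Submodule.mem_sup_right (Submodule.smul_mem _ _ (Submodule.mem_span_singleton_self e))
  have hWmono : vals (G := G) W ≤ vals (W ⊔ Submodule.span k {v}) :=
    fun z hz g => Submodule.mem_sup_left (hz g)
  obtain ⟨T', hT1, hT2, hT3⟩ := ih _ hlt (W ⊔ Submodule.span k {v}) (by
    intro n hn
    obtain ⟨n, hn1, c, hc, rfl⟩ := Submodule.mem_sup.1 hn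
    obtain ⟨c, rfl⟩ := Submodule.mem_span_singleton.1 hc
    rw [Finsupp.single_add, map_add, ← Finsupp.smul_single, map_smul]
    refine Submodule.add_mem _ (hWmono (hNW n hn1)) (Submodule.smul_mem _ _ ?_)
    have := Submodule.add_mem _ (hWmono hev) (single_mem_vals (h := γ)
      (Submodule.mem_sup_right (S := W) (Submodule.mem_span_singleton_self (R := k) v)))
    simpa using this)
  by_cases hvW : v ∈ W
  · have hW' : W ⊔ Submodule.span k {v} = W := by
      rw [sup_eq_left, Submodule.span_singleton_le_iff_mem]; exact hvW
    rw [hW'] at hT1 hT3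
    refine ⟨T' ⊔ Submodule.span k {Finsupp.single 1 e}, ?_, ?_, ?_⟩
    · refine sup_le hT1 ?_
      rw [Submodule.span_singleton_le_iff_mem]
      have := Submodule.add_mem _ hev (single_mem_vals (h := γ) hvW)
      simpa using this
    · intro τ hτ hN
      obtain ⟨τ, hτ1, c, hc, rfl⟩ := Submodule.mem_sup.1 hτ
      obtain ⟨c, rfl⟩ := Submodule.mem_span_singleton.1 hc
      rw [map_add, map_smul, eps_single] at hN
      have h0 : τ = 0 := by
        apply hT2 τ hτ1
        have := Submodule.sub_mem _ (Submodule.mem_sup_left hN) (hmemN' c)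
        simpa using this
      subst h0
      rw [map_zero, zero_add] at hN
      rw [hcN c hN]; simp
    · refine hT3.trans (sup_le ?_ ?_)
      · refine le_sup_of_le_left (Submodule.span_mono ?_)
        rintro z ⟨g, τ, hτ, rfl⟩
        exact ⟨g, τ, Submodule.mem_sup_left hτ, rfl⟩
      · apply vals_le
        intro g n hn
        obtain ⟨n, hn1, c, hc, rfl⟩ := Submodule.mem_sup.1 hn
        obtain ⟨c, rfl⟩ := Submodule.mem_span_singleton.1 hc
        rw [Finsupp.single_add]
        refine Submodule.add_mem _ (Submodule.mem_sup_right (single_mem_vals hn1))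
          (Submodule.mem_sup_left (Submodule.subset_span ⟨g, c • Finsupp.single 1 e, ?_, ?_⟩))
        · exact Submodule.mem_sup_right (Submodule.smul_mem _ _ (Submodule.mem_span_singleton_self _))
        · rw [map_smul, tr_single, one_mul, Finsupp.smul_single]
  · obtain ⟨φ0, hφ0, hφ1⟩ := Submodule.exists_le_ker_of_notMem hvW
    let φ : V →ₗ[k] k := (φ0 v)⁻¹ • φ0
    have φv : φ v = 1 := by simp [φ, hφ0]
    have φW : ∀ w ∈ W, φ w = 0 := by
      intro w hw
      have : φ0 w = 0 := hφ1 hw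
      simp [φ, this]
    let S : (G →₀ V) →ₗ[k] (G →₀ E) :=
      Finsupp.lmapDomain E k (γ⁻¹ * ·) ∘ₗ
        Finsupp.mapRange.linearMap (LinearMap.toSpanSingleton k E e ∘ₗ φ)
    have Ss : ∀ h w, S (Finsupp.single h w) = Finsupp.single (γ⁻¹ * h) (φ w • e) := by
      intro h w
      simp [S]
    have SW : ∀ z ∈ vals W, S z = 0 := by
      have : vals W ≤ LinearMap.ker S := by
        apply vals_le
        intro g w hw
        rw [LinearMap.mem_ker, Ss, φW w hw]; simp
      exact this
    have Str : ∀ g z, S (tr k g z) = tr k g (S z) := by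
      intro g z
      induction z using Finsupp.induction_linear with
      | zero => simp
      | add a b ha hb => simp only [map_add, ha, hb]
      | single h w => rw [tr_single, Ss, Ss, tr_single, mul_assoc]
    let L : (G →₀ E) →ₗ[k] (G →₀ E) := LinearMap.id - S ∘ₗ d
    have Ldef : ∀ z, L z = z - S (d z) := fun z => rfl
    have Ltr : ∀ g z, L (tr k g z) = tr k g (L z) := by
      intro g z
      rw [Ldef, Ldef, hd, Str, map_sub]
    have dS : ∀ w ∈ vals (W ⊔ Submodule.span k {v}), w - d (S w) ∈ vals W := by
      have : vals (W ⊔ Submodule.span k {v}) ≤ (vals W).comap (LinearMap.id - d ∘ₗ S) := by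
        apply vals_le
        intro h w hw
        obtain ⟨w, hw1, c, hc, rfl⟩ := Submodule.mem_sup.1 hw
        obtain ⟨c, rfl⟩ := Submodule.mem_span_singleton.1 hc
        change _ - d (S _) ∈ vals W
        rw [Ss, map_add, φW w hw1, map_smul, φv, zero_add, smul_eq_mul, mul_one, hs,
          ← Finsupp.smul_single, map_smul, map_smul]
        have h1 := tr_vals (γ⁻¹ * h) hev
        rw [map_sub, tr_single] at h1
        have h2 := Submodule.smul_mem _ c h1
        have h3 := Submodule.sub_mem _ (single_mem_vals (h := h) hw1) h2
        convert h3 using 1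
        rw [Finsupp.single_add, smul_sub, Finsupp.smul_single, mul_inv_cancel_left, LinearMap.id_apply]
        abel
      exact this
    have LN : vals (N ⊔ Submodule.span k {e}) ≤ (vals N).comap L := by
      apply vals_le
      intro h w hw
      obtain ⟨n, hn, c, hc, rfl⟩ := Submodule.mem_sup.1 hw
      obtain ⟨c, rfl⟩ := Submodule.mem_span_singleton.1 hc
      rw [Submodule.mem_comap, Finsupp.single_add, map_add]
      refine Submodule.add_mem _ ?_ ?_
      · rw [Ldef, hs, SW _ (tr_vals h (hNW n hn)), sub_zero]
        exact single_mem_vals hn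
      · have h1 := SW _ (tr_vals h hev)
        rw [map_sub, tr_single, map_sub, sub_eq_zero, Ss, φv, one_smul, ← hs,
          inv_mul_cancel_left] at h1
        rw [← Finsupp.smul_single, map_smul, Ldef, h1, sub_self, smul_zero]
        exact Submodule.zero_mem _
    refine ⟨T'.map L, ?_, ?_, ?_⟩
    · rintro _ ⟨τ, hτ, rfl⟩
      rw [Submodule.mem_comap, Ldef, map_sub]
      exact dS _ (hT1 hτ)
    · rintro _ ⟨τ, hτ, rfl⟩ hN
      have : τ = 0 := by
        apply hT2 τ hτ
        rw [Ldef, map_sub] at hN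
        have h1 : ∀ w, eps k (S w) ∈ Submodule.span k {e} := by
          intro w
          induction w using Finsupp.induction_linear with
          | zero => simp
          | add a b ha hb => simp only [map_add]; exact Submodule.add_mem _ ha hb
          | single h w =>
            rw [Ss, eps_single]
            exact Submodule.smul_mem _ _ (Submodule.mem_span_singleton_self _)
        have := Submodule.add_mem_sup hN (h1 (d τ))
        simpa using this
      rw [this, map_zero]
    · intro r hr
      have hr' : L r = r := by
        rw [Ldef, SW _ hr, sub_zero]
      rw [← hr']
      have h1 := hT3 (hWmono hr : r ∈ (vals (W ⊔ Submodule.span k {v})).comap d)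
      rw [← Submodule.mem_comap]
      revert h1
      suffices hle : Submodule.span k {z | ∃ g, ∃ τ ∈ T', z = tr k g τ} ⊔ vals (N ⊔ Submodule.span k {e}) ≤ (Submodule.span k {z | ∃ g, ∃ τ ∈ T'.map L, z = tr k g τ} ⊔ vals N).comap L from fun h => hle h
      refine sup_le ?_ ?_
      · rw [Submodule.span_le]
        rintro z ⟨g, τ, hτ, rfl⟩
        refine Submodule.mem_sup_left (Submodule.subset_span ⟨g, L τ, ⟨τ, hτ, rfl⟩, Ltr g τ⟩)
      · exact LN.trans (Submodule.comap_mono le_sup_right)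

end abs
end JoinRank


namespace JoinRank
section conc
set_option linter.unusedSectionVars false

theorem sum_mem_one {k V ι : Type*} [Field k] [AddCommGroup V] [Module k V] [Fintype ι]
    (W : Submodule k V) (f : ι → V) (i : ι) (hs : ∑ j, f j ∈ W) (h : ∀ j, j ≠ i → f j ∈ W) :
    f i ∈ W := by
  classical
  rw [← Finset.add_sum_erase _ _ (Finset.mem_univ i)] at hs
  exact (W.add_mem_iff_left (Submodule.sum_mem _ fun j hj => h j (Finset.ne_of_mem_erase hj))).1 hs

open FreeGroup in
theorem tree_sum {X k V : Type*} [Fintype X] [Field k] [AddCommGroup V] [Module k V]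
    (W : Submodule k V) (α β : X → FreeGroup X → V) (Good : X → FreeGroup X → Prop)
    (h1 : ∀ i h, Good i h → α i h ∈ W ∧ β i h ∈ W)
    (h2 : ∀ i h, α i h ∈ W → Good i h) (h3 : ∀ i h, β i h ∈ W → Good i h)
    (hfin : {p : X × FreeGroup X | ¬ Good p.1 p.2}.Finite)
    (hs : ∀ g, ∑ j, (α j (of j * g) - β j g) ∈ W) (i : X) (h : FreeGroup X) : Good i h := by
  have := tree_lemma _ hfin (by
    rintro ⟨i, h⟩ hbad g hg
    by_contra hcon
    push Not at hcon
    have good1 : ∀ j, (j, g) ≠ (i, h) → Good j g := by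
      intro j hj
      by_contra hb
      exact (hcon _ hb hj).1 rfl
    have good2 : ∀ j, (j, of j * g) ≠ (i, h) → Good j (of j * g) := by
      intro j hj
      by_contra hb
      exact (hcon _ hb hj).2 (by simp)
    apply hbad
    simp only at hg ⊢
    rcases hg with rfl | hg
    · apply h3
      have := sum_mem_one W _ i (hs g) (by
        intro j hj
        refine W.sub_mem (h1 _ _ (good2 j ?_)).1 (h1 _ _ (good1 j ?_)).2
        · simp [hj]
        · simp [hj])
      rw [sub_eq_add_neg, W.add_mem_iff_right (h1 _ _ (good2 i ?_)).1, W.neg_mem_iff] at this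
      · exact this
      · simp
    · have hh : h = of i * g := by simp [hg]
      subst hh
      apply h2
      have := sum_mem_one W _ i (hs g) (by
        intro j hj
        refine W.sub_mem (h1 _ _ (good2 j ?_)).1 (h1 _ _ (good1 j ?_)).2
        · simp [hj]
        · simp [hj])
      rw [sub_eq_add_neg, W.add_mem_iff_left (W.neg_mem (h1 _ _ (good1 i ?_)).2)] at this
      · exact this
      · simp)
  by_contra hb
  have hm : (i, h) ∈ {p : X × FreeGroup X | ¬ Good p.1 p.2} := hb
  rw [this] at hm
  exact hm

end conc
end JoinRank


namespace JoinRank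
section conc
set_option linter.unusedSectionVars false

/-- group element in group algebra -/
noncomputable def gs (k : Type*) [Field k] {G : Type*} [Group G] (g : G) : MonoidAlgebra k G :=
  MonoidAlgebra.single g 1

section
variable (k : Type*) [Field k] {G : Type*} [Group G]
theorem gs_mul (g h : G) : gs k (g * h) = gs k g * gs k h := by
  simp [gs]
@[simp] theorem gs_one : gs k (1 : G) = 1 := rfl
@[simp] theorem gs_inv (g : G) : gs k g * gs k g⁻¹ = 1 := by rw [← gs_mul]; simp
@[simp] theorem gs_inv' (g : G) : gs k g⁻¹ * gs k g = 1 := by rw [← gs_mul]; simp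

theorem ga_induction {motive : MonoidAlgebra k G → Prop} (x : MonoidAlgebra k G) (zero : motive 0)
    (add : ∀ x y, motive x → motive y → motive (x + y))
    (sm : ∀ (c : k) g, motive (c • gs k g)) : motive x := by
  induction x using MonoidAlgebra.induction_linear with
  | zero => exact zero
  | add x y hx hy => exact add x y hx hy
  | single g c =>
    have := sm c g
    simpa [gs] using this
end

variable {k : Type*} [Field k] {X : Type*} [Fintype X]

open FreeGroup in
/-- tree boundary -/
noncomputable def dt (U : Submodule k (MonoidAlgebra k (FreeGroup X))) :
    (FreeGroup X →₀ (X → U)) →ₗ[k] (FreeGroup X →₀ MonoidAlgebra k (FreeGroup X)) :=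
  Finsupp.lsum k fun h => ∑ i : X,
    (Finsupp.lsingle ((of i)⁻¹ * h) ∘ₗ LinearMap.mulRight k (gs k (of i)) - Finsupp.lsingle h) ∘ₗ
      U.subtype ∘ₗ LinearMap.proj i

open FreeGroup in
theorem dt_single (U : Submodule k (MonoidAlgebra k (FreeGroup X))) (h : FreeGroup X) (u : X → U) :
    dt U (Finsupp.single h u) = ∑ i : X,
      (Finsupp.single ((of i)⁻¹ * h) ((u i : MonoidAlgebra k (FreeGroup X)) * gs k (of i))
        - Finsupp.single h (u i : MonoidAlgebra k (FreeGroup X))) := by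
  simp [dt]

open FreeGroup in
theorem dt_apply (U : Submodule k (MonoidAlgebra k (FreeGroup X))) (z : FreeGroup X →₀ (X → U))
    (h : FreeGroup X) :
    dt U z h = ∑ i : X,
      (((z (of i * h) i : U) : MonoidAlgebra k (FreeGroup X)) * gs k (of i)
        - ((z h i : U) : MonoidAlgebra k (FreeGroup X))) := by
  classical
  induction z using Finsupp.induction_linear with
  | zero => simp
  | add a b ha hb =>
    rw [map_add, Finsupp.add_apply, ha, hb, ← Finset.sum_add_distrib]
    refine Finset.sum_congr rfl fun i _ => ?_
    simp [add_mul]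
    abel
  | single g u =>
    rw [dt_single, Finsupp.finsetSum_apply]
    refine Finset.sum_congr rfl fun i _ => ?_
    rw [Finsupp.sub_apply, Finsupp.single_apply, Finsupp.single_apply, Finsupp.single_apply,
      Finsupp.single_apply]
    have : ((of i)⁻¹ * g = h) ↔ (g = of i * h) := inv_mul_eq_iff_eq_mul
    simp only [this]
    split_ifs <;> simp

/-- theta -/
noncomputable def theta (k : Type*) [Field k] (a : Fin 4 → FreeGroup X) :
    (Fin 4 → k) →ₗ[k] MonoidAlgebra k (FreeGroup X) :=
  Fintype.linearCombination k (fun j => gs k (a j) - 1)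

theorem theta_apply (a : Fin 4 → FreeGroup X) (c : Fin 4 → k) :
    theta k a c = ∑ j, c j • (gs k (a j) - 1) := by
  simp [theta, Fintype.linearCombination_apply]

/-- full boundary -/
noncomputable def dd (U : Submodule k (MonoidAlgebra k (FreeGroup X))) (a : Fin 4 → FreeGroup X) :
    (FreeGroup X →₀ (X → U) × (Fin 4 → k)) →ₗ[k] (FreeGroup X →₀ MonoidAlgebra k (FreeGroup X)) :=
  dt U ∘ₗ Finsupp.mapRange.linearMap (LinearMap.fst k _ _) -
    Finsupp.mapRange.linearMap (theta k a ∘ₗ LinearMap.snd k _ _)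

theorem dd_single (U : Submodule k (MonoidAlgebra k (FreeGroup X))) (a : Fin 4 → FreeGroup X)
    (h : FreeGroup X) (e : (X → U) × (Fin 4 → k)) :
    dd U a (Finsupp.single h e) = dt U (Finsupp.single h e.1) -
      Finsupp.single h (theta k a e.2) := by
  simp [dd]

theorem dd_apply (U : Submodule k (MonoidAlgebra k (FreeGroup X))) (a : Fin 4 → FreeGroup X)
    (z : FreeGroup X →₀ (X → U) × (Fin 4 → k)) (h : FreeGroup X) :
    dd U a z h = ∑ i : X,
      ((((z (FreeGroup.of i * h)).1 i : U) : MonoidAlgebra k (FreeGroup X)) * gs k (FreeGroup.of i)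
        - (((z h).1 i : U) : MonoidAlgebra k (FreeGroup X))) - theta k a (z h).2 := by
  simp [dd, dt_apply]

theorem dd_tr (U : Submodule k (MonoidAlgebra k (FreeGroup X))) (a : Fin 4 → FreeGroup X)
    (g : FreeGroup X) (z : FreeGroup X →₀ (X → U) × (Fin 4 → k)) :
    dd U a (tr k g z) = tr k g (dd U a z) := by
  induction z using Finsupp.induction_linear with
  | zero => simp
  | add a b ha hb => simp only [map_add, ha, hb]
  | single h e => simp only [dd_single, dt_single, map_sub, map_sum, tr_single, mul_assoc]

open FreeGroup in
theorem dd_H (U : Submodule k (MonoidAlgebra k (FreeGroup X))) (a : Fin 4 → FreeGroup X)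
    (N : Submodule k ((X → U) × (Fin 4 → k))) (W : Submodule k (MonoidAlgebra k (FreeGroup X)))
    (hNW : ∀ n ∈ N, dd U a (Finsupp.single 1 n) ∈ vals W) :
      ((vals W).comap (dd U a) ≤ vals N) ∨
        ∃ e, e ∉ N ∧ ∃ v γ, dd U a (Finsupp.single 1 e) - Finsupp.single γ v ∈ vals W := by
  classical
  by_contra hcon
  push Not at hcon
  obtain ⟨hK, hcon⟩ := hcon
  apply hK
  have ds : ∀ i (u : U), dd U a (Finsupp.single 1 ((Pi.single i u, 0) : (X → U) × (Fin 4 → k))) =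
      Finsupp.single (of i)⁻¹ ((u : MonoidAlgebra k (FreeGroup X)) * gs k (of i)) -
        Finsupp.single 1 (u : MonoidAlgebra k (FreeGroup X)) := by
    intro i u
    rw [dd_single, dt_single, Finset.sum_eq_single i]
    · simp
    · intro j _ hj; simp [hj]
    · simp
  have hA : ∀ c, ((0, c) : (X → U) × (Fin 4 → k)) ∈ N := by
    intro c
    by_contra h
    apply hcon _ h (- theta k a c) 1
    rw [dd_single]
    simp
  have hB : ∀ i (u : U), (u : MonoidAlgebra k (FreeGroup X)) ∈ W →
      ((Pi.single i u, 0) : (X → U) × (Fin 4 → k)) ∈ N := by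
    intro i u hu
    by_contra h
    apply hcon _ h ((u : MonoidAlgebra k (FreeGroup X)) * gs k (of i)) (of i)⁻¹
    rw [ds]
    simpa using single_mem_vals hu
  have hC : ∀ i (u : U), (u : MonoidAlgebra k (FreeGroup X)) * gs k (of i) ∈ W →
      ((Pi.single i u, 0) : (X → U) × (Fin 4 → k)) ∈ N := by
    intro i u hu
    by_contra h
    apply hcon _ h (-(u : MonoidAlgebra k (FreeGroup X))) 1
    rw [ds]
    simpa using single_mem_vals hu
  have hθ : ∀ c, theta k a c ∈ W := by
    intro c
    have := hNW _ (hA c) 1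
    rw [dd_single] at this
    simpa using this
  intro z hz
  have good := tree_sum W
    (fun i h => (((z h).1 i : U) : MonoidAlgebra k (FreeGroup X)) * gs k (of i))
    (fun i h => (((z h).1 i : U) : MonoidAlgebra k (FreeGroup X)))
    (fun i h => ((Pi.single i ((z h).1 i), 0) : (X → U) × (Fin 4 → k)) ∈ N)
    (by
      intro i h hg
      have := hNW _ hg
      rw [ds] at this
      constructor
      · have := this (of i)⁻¹
        simpa [Finsupp.single_apply] using this
      · have := this 1
        simpa [Finsupp.single_apply] using this)
    (fun i h hw => hC _ _ hw) (fun i h hw => hB _ _ hw)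
    (by
      refine (Set.toFinite ((Finset.univ : Finset X) ×ˢ z.support : Finset (X × FreeGroup X))).subset ?_
      rintro ⟨i, h⟩ hb
      simp only [Finset.coe_product, Set.mem_prod, Finset.mem_coe, Finset.mem_univ, true_and,
        Finsupp.mem_support_iff]
      intro h0
      apply hb
      simp only [h0, Prod.fst_zero, Pi.zero_apply, Pi.single_zero]
      exact N.zero_mem)
    (by
      intro g
      have := W.add_mem (hz g) (hθ (z g).2)
      rw [dd_apply, sub_add_cancel] at this
      exact this)
  intro h
  have : z h = ∑ i, ((Pi.single i ((z h).1 i), 0) : (X → U) × (Fin 4 → k)) + (0, (z h).2) := by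
    apply Prod.ext
    · simp only [Prod.fst_add, Prod.fst_sum, add_zero]
      exact (Finset.univ_sum_single _).symm
    · simp [Prod.snd_sum]
  rw [this]
  exact N.add_mem (Submodule.sum_mem _ fun i _ => good i h) (hA _)

end conc
end JoinRank


namespace JoinRank
section conc
set_option linter.unusedSectionVars false
variable {k : Type*} [Field k] {X : Type*}

open Classical in
/-- exponent sum vector -/
noncomputable def expo (k : Type*) [Field k] {n : ℕ} (ι : Fin n → X) :
    FreeGroup X →* Multiplicative (Fin n → k) :=
  FreeGroup.lift fun x => Multiplicative.ofAdd (fun j => if ι j = x then (1 : k) else 0)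

/-- exponent matrix -/
noncomputable def expoA (k : Type*) [Field k] {n m : ℕ} (ι : Fin n → X) (a : Fin m → FreeGroup X) :
    (Fin m → k) →ₗ[k] (Fin n → k) :=
  Fintype.linearCombination k (fun j => (expo k ι (a j)).toAdd)

theorem expoA_surj {n m : ℕ} (ι : Fin n → X) (hι : Function.Injective ι) (a : Fin m → FreeGroup X)
    (ha : Subgroup.closure (Set.range a) = ⊤) : Function.Surjective (expoA k ι a) := by
  classical
  rw [← LinearMap.range_eq_top, expoA, Fintype.range_linearCombination, eq_top_iff]
  have key : ∀ g : FreeGroup X, (expo k ι g).toAdd ∈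
      Submodule.span k (Set.range fun j => (expo k ι (a j)).toAdd) := by
    intro g
    have hg : g ∈ Subgroup.closure (Set.range a) := by rw [ha]; trivial
    induction hg using Subgroup.closure_induction with
    | mem x hx =>
      obtain ⟨j, rfl⟩ := hx
      exact Submodule.subset_span ⟨j, rfl⟩
    | one => simp
    | mul x y _ _ h1 h2 => rw [map_mul, toAdd_mul]; exact Submodule.add_mem _ h1 h2
    | inv x _ h1 => rw [map_inv, toAdd_inv]; exact Submodule.neg_mem _ h1
  intro v _
  have hv : v = ∑ j, v j • (expo k ι (FreeGroup.of (ι j))).toAdd := by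
    ext l
    simp [expo, Finset.sum_apply, hι.eq_iff]
  rw [hv]
  exact Submodule.sum_mem _ fun j _ => Submodule.smul_mem _ _ (key _)

theorem gens_card {n m : ℕ} (ι : Fin n → X) (hι : Function.Injective ι) (a : Fin m → FreeGroup X)
    (ha : Subgroup.closure (Set.range a) = ⊤) : n ≤ m := by
  have := LinearMap.finrank_le_finrank_of_surjective (f := expoA ℚ ι a) (expoA_surj ι hι a ha)
  simpa using this

variable [Fintype X]

/-- multiply out -/
noncomputable def Lam (k : Type*) [Field k] {G : Type*} [Group G] :
    (G →₀ MonoidAlgebra k G) →ₗ[k] MonoidAlgebra k G :=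
  Finsupp.lsum k fun h => LinearMap.mulRight k (gs k h)

@[simp] theorem Lam_single {G : Type*} [Group G] (h : G) (v : MonoidAlgebra k G) :
    Lam k (Finsupp.single h v) = v * gs k h := by
  simp [Lam]

theorem Lam_dt (U : Submodule k (MonoidAlgebra k (FreeGroup X))) (z : FreeGroup X →₀ (X → U)) :
    Lam k (dt U z) = 0 := by
  induction z using Finsupp.induction_linear with
  | zero => simp
  | add a b ha hb => simp only [map_add, ha, hb, add_zero]
  | single h u =>
    rw [dt_single, map_sum]
    refine Finset.sum_eq_zero fun i _ => ?_
    rw [map_sub, Lam_single, Lam_single, mul_assoc, ← gs_mul, mul_inv_cancel_left, sub_self]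

/-- derivation part -/
noncomputable def Der (k : Type*) [Field k] {n : ℕ} (ι : Fin n → X) :
    MonoidAlgebra k (FreeGroup X) →ₗ[k] (Fin n → k) :=
  (Finsupp.linearCombination k fun g => (expo k ι g).toAdd) ∘ₗ
    (MonoidAlgebra.coeffLinearEquiv k).toLinearMap

theorem Der_gs {n : ℕ} (ι : Fin n → X) (g : FreeGroup X) :
    Der k ι (gs k g) = (expo k ι g).toAdd := by
  simp [Der, gs]

theorem Der_theta {n : ℕ} (ι : Fin n → X) (a : Fin 4 → FreeGroup X) (c : Fin 4 → k)
    (h : FreeGroup X) : Der k ι (theta k a c * gs k h) = expoA k ι a c := by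
  rw [theta_apply, Finset.sum_mul, map_sum, expoA, Fintype.linearCombination_apply]
  refine Finset.sum_congr rfl fun j _ => ?_
  rw [smul_mul_assoc, map_smul, sub_mul, one_mul, ← gs_mul, map_sub, Der_gs, Der_gs, map_mul,
    toAdd_mul, add_sub_cancel_right]

theorem Der_Lam_dd {n : ℕ} (ι : Fin n → X) (U : Submodule k (MonoidAlgebra k (FreeGroup X)))
    (a : Fin 4 → FreeGroup X) (z : FreeGroup X →₀ (X → U) × (Fin 4 → k)) :
    Der k ι (Lam k (dd U a z)) = - expoA k ι a (eps k z).2 := by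
  induction z using Finsupp.induction_linear with
  | zero => simp
  | add a b ha hb => simp only [map_add, ha, hb, Prod.snd_add, neg_add]
  | single h e =>
    rw [dd_single, map_sub, Lam_dt, Lam_single, zero_sub, map_neg, Der_theta, eps_single]

theorem eps_dd (U : Submodule k (MonoidAlgebra k (FreeGroup X)))
    (a : Fin 4 → FreeGroup X) (z : FreeGroup X →₀ (X → U) × (Fin 4 → k)) :
    eps k (dd U a z) = ∑ i : X,
      ((((eps k z).1 i : U) : MonoidAlgebra k (FreeGroup X)) * gs k (FreeGroup.of i)
        - (((eps k z).1 i : U) : MonoidAlgebra k (FreeGroup X))) - theta k a (eps k z).2 := by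
  induction z using Finsupp.induction_linear with
  | zero => simp
  | add a b ha hb =>
    simp only [map_add, ha, hb, Prod.snd_add, Prod.fst_add, Pi.add_apply, Submodule.coe_add,
      add_mul, Finset.sum_add_distrib, Finset.sum_sub_distrib]
    abel
  | single h e =>
    simp only [dd_single, dt_single, map_sub, map_sum, eps_single]

theorem tree_inj (u : X → MonoidAlgebra k (FreeGroup X))
    (hu : ∑ i, (u i * gs k (FreeGroup.of i) - u i) = 0) (i : X) : u i = 0 := by
  classical
  have good := tree_sum (⊥ : Submodule k k) (fun i h => (u i).coeff h⁻¹)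
    (fun i h => (u i).coeff h⁻¹) (fun i h => (u i).coeff h⁻¹ = 0)
    (fun i h hg => ⟨(Submodule.mem_bot k).2 hg, (Submodule.mem_bot k).2 hg⟩)
    (fun i h hg => (Submodule.mem_bot k).1 hg) (fun i h hg => (Submodule.mem_bot k).1 hg)
    (by
      have : (⋃ i : X, Prod.mk i '' ((fun h : FreeGroup X => h⁻¹) '' (u i).coeff.support)).Finite :=
        Set.finite_iUnion fun i => ((Finset.finite_toSet _).image _).image _
      refine this.subset ?_
      rintro ⟨i, h⟩ hb
      rw [Set.mem_iUnion]
      exact ⟨i, h, ⟨h⁻¹, by simpa using hb, by simp⟩, rfl⟩)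
    (by
      intro g
      have := congrArg (fun v => MonoidAlgebra.coeffLinearEquiv k v g⁻¹) hu
      simp only [map_sum, map_zero, Finsupp.finsetSum_apply] at this
      rw [Submodule.mem_bot]
      rw [← Finsupp.zero_apply (M := k) (a := g⁻¹), ← this]
      refine Finset.sum_congr rfl fun j _ => ?_
      simp [gs])
  rw [← MonoidAlgebra.coeff_inj]
  ext h
  have := good i h⁻¹
  simpa using this

theorem rank_one (U : Submodule k (MonoidAlgebra k (FreeGroup X))) [FiniteDimensional k U]
    (a : Fin 4 → FreeGroup X) (ha : Subgroup.closure (Set.range a) = ⊤)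
    (ι : Fin 3 → X) (hι : Function.Injective ι) :
    ∃ κ : FreeGroup X →₀ (X → U) × (Fin 4 → k),
      LinearMap.ker (dd U a) ≤ Submodule.span k {z | ∃ g, z = tr k g κ} := by
  obtain ⟨T, hT1, hT2, hT3⟩ := abs_lemma (dd U a) (dd_tr U a) (dd_H U a) ⊥ ⊥ (by
    intro n hn
    rw [Submodule.mem_bot] at hn
    simp [hn])
  have v0 : ∀ {V : Type _} [AddCommGroup V] [Module k V] (z : FreeGroup X →₀ V),
      z ∈ vals (⊥ : Submodule k V) ↔ z = 0 := by
    intro V _ _ z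
    rw [mem_vals]
    constructor
    · intro h; ext1 g; exact h g
    · rintro rfl g; simp
  have v0' : vals (G := FreeGroup X) (⊥ : Submodule k ((X → U) × (Fin 4 → k))) = ⊥ := by
    ext z; rw [Submodule.mem_bot, mem_vals]
    constructor
    · intro h; ext1 g; exact h g
    · rintro rfl g; simp
  have hker : ∀ τ ∈ T, dd U a τ = 0 := fun τ hτ => (v0 _).1 (hT1 hτ)
  let f : T →ₗ[k] LinearMap.ker (expoA k ι a) :=
    LinearMap.codRestrict _ (LinearMap.snd k _ _ ∘ₗ eps k ∘ₗ T.subtype) (by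
      rintro ⟨τ, hτ⟩
      have := Der_Lam_dd ι U a τ
      rw [hker τ hτ, map_zero, map_zero, zero_eq_neg] at this
      exact this)
  have finj : Function.Injective f := by
    rw [injective_iff_map_eq_zero]
    rintro ⟨τ, hτ⟩ h0
    have hc : (eps k τ).2 = 0 := congrArg Subtype.val h0
    have h1 := eps_dd U a τ
    rw [hker τ hτ, hc, map_zero, map_zero, sub_zero] at h1
    have h2 := tree_inj _ h1.symm
    ext1
    apply hT2 τ hτ
    rw [Submodule.mem_bot]
    apply Prod.ext
    · funext i
      exact Subtype.ext (h2 i)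
    · exact hc
  haveI : FiniteDimensional k T := FiniteDimensional.of_injective f finj
  have hfr : Module.finrank k T ≤ 1 := by
    have h1 := LinearMap.finrank_le_finrank_of_injective finj
    have h2 := LinearMap.finrank_range_add_finrank_ker (expoA k ι a)
    rw [LinearMap.range_eq_top.2 (expoA_surj ι hι a ha)] at h2
    simp at h2
    omega
  obtain ⟨κ, hκ⟩ := finrank_le_one_iff.1 hfr
  refine ⟨κ, ?_⟩
  intro z hz
  have hz' := hT3 (show z ∈ (vals ⊥).comap (dd U a) from (v0 _).2 hz)
  rw [v0', sup_bot_eq] at hz'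
  refine Submodule.span_le.2 ?_ hz'
  rintro _ ⟨g, τ, hτ, rfl⟩
  obtain ⟨c, hc⟩ := hκ ⟨τ, hτ⟩
  have : τ = c • (κ : FreeGroup X →₀ (X → U) × (Fin 4 → k)) := (congrArg Subtype.val hc).symm
  rw [this, map_smul]
  exact Submodule.smul_mem _ _ (Submodule.subset_span ⟨g, rfl⟩)

end conc
end JoinRank


namespace JoinRank
section conc
set_option linter.unusedSectionVars false
variable {k : Type*} [Field k] {X : Type*} [Fintype X]

/-- tree relations -/
noncomputable def Qs (S : Set (MonoidAlgebra k (FreeGroup X))) :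
    Submodule k (FreeGroup X →₀ MonoidAlgebra k (FreeGroup X)) :=
  Submodule.span k {z | ∃ i : X, ∃ h : FreeGroup X, ∃ u ∈ S,
    z = Finsupp.single ((FreeGroup.of i)⁻¹ * h) (u * gs k (FreeGroup.of i)) - Finsupp.single h u}

theorem Qs_mono {S S' : Set (MonoidAlgebra k (FreeGroup X))} (h : S ⊆ S') : Qs S ≤ Qs S' := by
  refine Submodule.span_mono ?_
  rintro z ⟨i, h', u, hu, rfl⟩
  exact ⟨i, h', u, h hu, rfl⟩

theorem Qs_le (S : Set (MonoidAlgebra k (FreeGroup X))) :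
    Qs S ≤ LinearMap.range (dt (Submodule.span k S)) := by
  classical
  refine Submodule.span_le.2 ?_
  rintro z ⟨i, h, u, hu, rfl⟩
  refine ⟨Finsupp.single h (Pi.single i ⟨u, Submodule.subset_span hu⟩), ?_⟩
  rw [dt_single, Finset.sum_eq_single i]
  · simp
  · intro j _ hj; simp [hj]
  · simp

theorem Qs_mul (S : Set (MonoidAlgebra k (FreeGroup X))) (g : FreeGroup X)
    (z : FreeGroup X →₀ MonoidAlgebra k (FreeGroup X)) (hz : z ∈ Qs S) :
    Finsupp.mapRange.linearMap (LinearMap.mulLeft k (gs k g)) z ∈ Qs ((gs k g * ·) '' S) := by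
  have : Qs S ≤ (Qs ((gs k g * ·) '' S)).comap
      (Finsupp.mapRange.linearMap (LinearMap.mulLeft k (gs k g))) := by
    refine Submodule.span_le.2 ?_
    rintro z ⟨i, h, u, hu, rfl⟩
    refine Submodule.subset_span ⟨i, h, gs k g * u, ⟨u, hu, rfl⟩, ?_⟩
    rw [map_sub, Finsupp.mapRange.linearMap_apply, Finsupp.mapRange.linearMap_apply,
      Finsupp.mapRange_single, Finsupp.mapRange_single, LinearMap.mulLeft_apply,
      LinearMap.mulLeft_apply, mul_assoc]
  exact this hz

theorem exists_S (k : Type*) [Field k] (g : FreeGroup X) :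
    ∃ S : Set (MonoidAlgebra k (FreeGroup X)), S.Finite ∧
      ∀ h, Finsupp.single h (gs k g) - Finsupp.single (g * h) 1 ∈ Qs S := by
  induction g using FreeGroup.induction_on with
  | C1 => exact ⟨∅, Set.finite_empty, fun h => by simp⟩
  | of i =>
    refine ⟨{1}, Set.finite_singleton _, fun h => Submodule.subset_span ⟨i, FreeGroup.of i * h, 1, rfl, ?_⟩⟩
    simp
  | inv_of i _ =>
    refine ⟨{gs k (FreeGroup.of i)⁻¹}, Set.finite_singleton _, fun h => ?_⟩
    rw [← Submodule.neg_mem_iff]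
    refine Submodule.subset_span ⟨i, h, _, rfl, ?_⟩
    simp
  | mul g g' h1 h2 =>
    obtain ⟨S, hS, h1⟩ := h1
    obtain ⟨S', hS', h2⟩ := h2
    refine ⟨S ∪ (gs k g * ·) '' S', hS.union (hS'.image _), fun h => ?_⟩
    have m1 := Qs_mono (Set.subset_union_left (t := (gs k g * ·) '' S')) (h1 (g' * h))
    have m2 := Qs_mono (Set.subset_union_right (s := S)) (Qs_mul S' g _ (h2 h))
    have m3 := Submodule.add_mem _ m1 m2
    rw [map_sub, Finsupp.mapRange.linearMap_apply, Finsupp.mapRange.linearMap_apply,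
      Finsupp.mapRange_single, Finsupp.mapRange_single, LinearMap.mulLeft_apply,
      LinearMap.mulLeft_apply, mul_one, ← gs_mul] at m3
    rw [mul_assoc]
    simpa using m3

/-- theta on chains -/
noncomputable def Th (k : Type*) [Field k] (a : Fin 4 → FreeGroup X) :
    (FreeGroup X →₀ (Fin 4 → k)) →ₗ[k] (FreeGroup X →₀ MonoidAlgebra k (FreeGroup X)) :=
  Finsupp.mapRange.linearMap (theta k a)

@[simp] theorem Th_single (a : Fin 4 → FreeGroup X) (h : FreeGroup X) (c : Fin 4 → k) :
    Th k a (Finsupp.single h c) = Finsupp.single h (theta k a c) := by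
  simp [Th]

/-- section of Lam modulo tree relations -/
noncomputable def Gam (k : Type*) [Field k] {X : Type*} :
    MonoidAlgebra k (FreeGroup X) →ₗ[k] (FreeGroup X →₀ MonoidAlgebra k (FreeGroup X)) :=
  (Finsupp.lmapDomain _ k id ∘ₗ Finsupp.mapRange.linearMap (LinearMap.toSpanSingleton k _ 1)) ∘ₗ
    (MonoidAlgebra.coeffLinearEquiv k).toLinearMap

theorem Gam_gs (g : FreeGroup X) : Gam k (gs k g) = Finsupp.single g 1 := by
  simp [Gam, gs]

theorem exists_U (k : Type*) [Field k] (a : Fin 4 → FreeGroup X) :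
    ∃ U : Submodule k (MonoidAlgebra k (FreeGroup X)), FiniteDimensional k U ∧
      ∀ w, Lam k (Th k a w) = 0 → Th k a w ∈ LinearMap.range (dt U) := by
  choose S hS hSj using fun j => exists_S k (a j)
  refine ⟨Submodule.span k (⋃ j, S j), FiniteDimensional.span_of_finite k (Set.finite_iUnion hS), ?_⟩
  have key : ∀ w, Th k a w - Gam k (Lam k (Th k a w)) ∈
      LinearMap.range (dt (Submodule.span k (⋃ j, S j))) := by
    intro w
    induction w using Finsupp.induction_linear with
    | zero => simp
    | add a b ha hb =>
      have := Submodule.add_mem _ ha hb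
      simp only [map_add]
      convert this using 1
      abel
    | single h c =>
      rw [Th_single, Lam_single, theta_apply, ← Finsupp.lsingle_apply (R := k), map_sum,
        Finset.sum_mul, map_sum, ← Finset.sum_sub_distrib]
      refine Submodule.sum_mem _ fun j _ => ?_
      rw [smul_mul_assoc, map_smul, map_smul, ← smul_sub]
      refine Submodule.smul_mem _ _ (Qs_le _ (Qs_mono (Set.subset_iUnion S j) ?_))
      rw [sub_mul, one_mul, ← gs_mul, map_sub, map_sub, Gam_gs, Gam_gs]
      simpa using hSj j h
  intro w hw
  have := key w
  rwa [hw, map_zero, sub_zero] at this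

theorem Lam_tr {G : Type*} [Group G] (g : G) (z : G →₀ MonoidAlgebra k G) :
    Lam k (tr k g z) = Lam k z * gs k g := by
  induction z using Finsupp.induction_linear with
  | zero => simp
  | add a b ha hb => simp only [map_add, ha, hb, add_mul]
  | single h u => rw [tr_single, Lam_single, Lam_single, gs_mul, mul_assoc]

theorem Th_tr (a : Fin 4 → FreeGroup X) (g : FreeGroup X) (z : FreeGroup X →₀ (Fin 4 → k)) :
    Th k a (tr k g z) = tr k g (Th k a z) := by
  induction z using Finsupp.induction_linear with
  | zero => simp
  | add a b ha hb => simp only [map_add, ha, hb]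
  | single h u => rw [tr_single, Th_single, Th_single, tr_single]

/-- vectors supported on J -/
def supN (k : Type*) [Field k] (J : Set (Fin 4)) : Submodule k (Fin 4 → k) where
  carrier := {c | ∀ j, j ∉ J → c j = 0}
  add_mem' := fun ha hb j hj => by simp [ha j hj, hb j hj]
  zero_mem' := fun _ _ => rfl
  smul_mem' := fun c x hx j hj => by simp [hx j hj]

theorem exists_w (k : Type*) [Field k] (a : Fin 4 → FreeGroup X) (J : Set (Fin 4)) (x : FreeGroup X)
    (hx : x ∈ Subgroup.closure (a '' J)) :
    ∃ w ∈ vals (supN k J), Lam k (Th k a w) = gs k x - 1 := by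
  classical
  induction hx using Subgroup.closure_induction with
  | mem x hx =>
    obtain ⟨j, hj, rfl⟩ := hx
    refine ⟨Finsupp.single 1 (Pi.single j 1), single_mem_vals ?_, ?_⟩
    · intro l hl
      have : l ≠ j := by rintro rfl; exact hl hj
      simp [this]
    · rw [Th_single, Lam_single, gs_one, mul_one, theta_apply, Finset.sum_eq_single j]
      · simp
      · intro l _ hl; simp [hl]
      · simp
  | one => exact ⟨0, Submodule.zero_mem _, by simp⟩
  | mul x y _ _ h1 h2 =>
    obtain ⟨w, hw, h1⟩ := h1
    obtain ⟨w', hw', h2⟩ := h2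
    refine ⟨tr k y w + w', Submodule.add_mem _ (tr_vals _ hw) hw', ?_⟩
    rw [map_add, map_add, Th_tr, Lam_tr, h1, h2, gs_mul]
    noncomm_ring
  | inv x _ h1 =>
    obtain ⟨w, hw, h1⟩ := h1
    refine ⟨- tr k x⁻¹ w, Submodule.neg_mem _ (tr_vals _ hw), ?_⟩
    rw [map_neg, map_neg, Th_tr, Lam_tr, h1, sub_mul, gs_inv]
    simp

end conc
end JoinRank


namespace JoinRank
section conc
set_option linter.unusedSectionVars false
variable {k : Type*} [Field k] {X : Type*}

/-- projection to first two coordinates -/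
noncomputable def pr (k : Type*) [Field k] : (Fin 4 → k) →ₗ[k] (Fin 4 → k) :=
  LinearMap.pi (fun j : Fin 4 => if j = 0 ∨ j = 1 then LinearMap.proj j else 0)

theorem pr_apply (c : Fin 4 → k) (j : Fin 4) : pr k c j = if j = 0 ∨ j = 1 then c j else 0 := by
  unfold pr
  rw [LinearMap.pi_apply]
  split_ifs <;> simp

theorem pr_01 (c : Fin 4 → k) (hc : c ∈ supN k {0, 1}) : pr k c = c := by
  ext j
  rw [pr_apply]
  split_ifs with h
  · rfl
  · exact (hc j (by simpa using h)).symm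

theorem pr_23 (c : Fin 4 → k) (hc : c ∈ supN k {2, 3}) : pr k c = 0 := by
  ext j
  rw [pr_apply]
  split_ifs with h
  · refine hc j ?_
    rcases h with rfl | rfl <;> simp
  · rfl

variable [Fintype X]

/-- partial evaluation -/
noncomputable def Psi (k : Type*) [Field k] (U : Submodule k (MonoidAlgebra k (FreeGroup X)))
    (a : Fin 4 → FreeGroup X) :
    (FreeGroup X →₀ (X → U) × (Fin 4 → k)) →ₗ[k] MonoidAlgebra k (FreeGroup X) :=
  Lam k ∘ₗ Th k a ∘ₗ Finsupp.mapRange.linearMap (pr k ∘ₗ LinearMap.snd k _ _)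

theorem Psi_single (U : Submodule k (MonoidAlgebra k (FreeGroup X)))
    (a : Fin 4 → FreeGroup X) (h : FreeGroup X) (e : (X → U) × (Fin 4 → k)) :
    Psi k U a (Finsupp.single h e) = theta k a (pr k e.2) * gs k h := by
  simp [Psi]

theorem Psi_tr (U : Submodule k (MonoidAlgebra k (FreeGroup X)))
    (a : Fin 4 → FreeGroup X) (g : FreeGroup X) (z : FreeGroup X →₀ (X → U) × (Fin 4 → k)) :
    Psi k U a (tr k g z) = Psi k U a z * gs k g := by
  induction z using Finsupp.induction_linear with
  | zero => simp
  | add a b ha hb => simp only [map_add, ha, hb, add_mul]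
  | single h e => rw [tr_single, Psi_single, Psi_single, gs_mul, mul_assoc]

/-- augmentation -/
noncomputable def aug (k : Type*) [Field k] (G : Type*) [Group G] : MonoidAlgebra k G →ₐ[k] k :=
  MonoidAlgebra.lift k k G 1

theorem aug_gs {G : Type*} [Group G] (g : G) : aug k G (gs k g) = 1 := by
  simp [aug, gs]

theorem aug_Psi (U : Submodule k (MonoidAlgebra k (FreeGroup X)))
    (a : Fin 4 → FreeGroup X) (z : FreeGroup X →₀ (X → U) × (Fin 4 → k)) :
    aug k _ (Psi k U a z) = 0 := by
  induction z using Finsupp.induction_linear with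
  | zero => simp
  | add a b ha hb => simp only [map_add, ha, hb, add_zero]
  | single h e =>
    rw [Psi_single, theta_apply, map_mul, map_sum, Finset.sum_eq_zero, zero_mul]
    intro j _
    rw [map_smul, map_sub, aug_gs, map_one, sub_self, smul_zero]

theorem exists_m (k : Type*) [Field k] (a : Fin 4 → FreeGroup X)
    (ha : Subgroup.closure (Set.range a) = ⊤)
    (ι : Fin 3 → X) (hι : Function.Injective ι) :
    ∃ m : MonoidAlgebra k (FreeGroup X), aug k _ m = 0 ∧
      ∀ x, x ∈ Subgroup.closure (a '' {0, 1}) → x ∈ Subgroup.closure (a '' {2, 3}) →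
        ∃ p, m * p = gs k x - 1 := by
  obtain ⟨U, hU, hU2⟩ := exists_U k a
  obtain ⟨κ, hκ⟩ := rank_one U a ha ι hι
  refine ⟨Psi k U a κ, aug_Psi U a κ, ?_⟩
  intro x hx1 hx2
  obtain ⟨w, hw, h1⟩ := exists_w k a _ x hx1
  obtain ⟨w', hw', h2⟩ := exists_w k a _ x hx2
  obtain ⟨u, hu⟩ := hU2 (w - w') (by rw [map_sub, map_sub, h1, h2, sub_self])
  let z : FreeGroup X →₀ (X → U) × (Fin 4 → k) :=
    Finsupp.mapRange.linearMap (LinearMap.inl k _ _) u +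
      Finsupp.mapRange.linearMap (LinearMap.inr k _ _) (w - w')
  have z1 : Finsupp.mapRange.linearMap (LinearMap.fst k _ _) z = u := by
    ext1 g; simp [z]
  have z2 : Finsupp.mapRange.linearMap (theta k a ∘ₗ LinearMap.snd k _ _) z = Th k a (w - w') := by
    ext1 g; simp [z, Th]
  have z3 : Finsupp.mapRange.linearMap (pr k ∘ₗ LinearMap.snd k _ _) z = w := by
    ext1 g
    simp [z, pr_01 _ (hw g), pr_23 _ (hw' g)]
  have hz : dd U a z = 0 := by
    rw [dd, LinearMap.sub_apply, LinearMap.comp_apply, z1, z2, hu, sub_self]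
  have hP : Psi k U a z = gs k x - 1 := by
    rw [Psi, LinearMap.comp_apply, LinearMap.comp_apply, z3, h1]
  rw [← hP]
  have hmem := hκ hz
  clear_value z
  clear hz hP z1 z2 z3
  induction hmem using Submodule.span_induction with
  | mem z h =>
    obtain ⟨g, rfl⟩ := h
    exact ⟨gs k g, (Psi_tr _ _ _ _).symm⟩
  | zero => exact ⟨0, by simp⟩
  | add z z' _ _ h h' =>
    obtain ⟨p, hp⟩ := h
    obtain ⟨q, hq⟩ := h'
    exact ⟨p + q, by rw [mul_add, hp, hq, map_add]⟩
  | smul c z _ h =>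
    obtain ⟨p, hp⟩ := h
    exact ⟨c • p, by rw [mul_smul_comm, hp, map_smul]⟩

theorem end_comm {Y : Type*} (m p : MonoidAlgebra k (FreeGroup Y)) (x : FreeGroup Y) (hx : x ≠ 1)
    (h : m * p = gs k x - 1) (f1 f2 : FreeGroup Y) (hf1 : m.coeff f1 ≠ 0) (hf2 : m.coeff f2 ≠ 0) :
    x * (f1 * f2⁻¹) = (f1 * f2⁻¹) * x := by
  have hu : (1 + p * m) * (1 - p * gs k x⁻¹ * m) = 1 := by
    have e : p * m * (p * gs k x⁻¹ * m) = p * ((m * p) * gs k x⁻¹) * m := by noncomm_ring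
    have : (1 + p * m) * (1 - p * gs k x⁻¹ * m) =
      1 + p * m - p * gs k x⁻¹ * m - p * m * (p * gs k x⁻¹ * m) := by noncomm_ring
    rw [this, e, h, sub_mul, gs_inv]
    noncomm_ring
  obtain ⟨g, c, hg⟩ := unit_trivial _ _ hu
  have hxm : gs k x * m = m * MonoidAlgebra.single g c := by
    rw [← hg]
    have : m * (1 + p * m) = m + (m * p) * m := by noncomm_ring
    rw [this, h]; noncomm_ring
  have step : ∀ f, m.coeff f ≠ 0 → m.coeff (x * f * g⁻¹) ≠ 0 := by
    intro f hf h0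
    have := congrArg (fun v => v.coeff (x * f)) hxm
    simp only [gs, MonoidAlgebra.coeff_single_mul_apply, MonoidAlgebra.coeff_mul_single_apply] at this
    rw [h0] at this
    simp at this
    exact hf this
  have iter : ∀ f, m.coeff f ≠ 0 → ∀ n : ℕ, m.coeff (x ^ n * f * (g ^ n)⁻¹) ≠ 0 := by
    intro f hf n
    induction n with
    | zero => simpa using hf
    | succ n ih =>
      have := step _ ih
      have e : x * (x ^ n * f * (g ^ n)⁻¹) * g⁻¹ = x ^ (n + 1) * f * (g ^ (n + 1))⁻¹ := by
        rw [pow_succ' x, pow_succ' g, mul_inv_rev]; group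
      rwa [e] at this
  let F : ℕ → m.coeff.support × m.coeff.support := fun n =>
    (⟨x ^ n * f1 * (g ^ n)⁻¹, by simpa using iter f1 hf1 n⟩,
      ⟨x ^ n * f2 * (g ^ n)⁻¹, by simpa using iter f2 hf2 n⟩)
  obtain ⟨n, n', hne, hF⟩ := Finite.exists_ne_map_eq_of_infinite F
  wlog hlt : n < n' generalizing n n'
  · exact this n' n hne.symm hF.symm (lt_of_le_of_ne (not_lt.1 hlt) hne.symm)
  obtain ⟨N, rfl⟩ := Nat.exists_eq_add_of_lt hlt
  simp only [F, Prod.mk.injEq, Subtype.mk.injEq] at hF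
  have key : ∀ f, x ^ n * f * (g ^ n)⁻¹ = x ^ (n + N + 1) * f * (g ^ (n + N + 1))⁻¹ →
      f⁻¹ * x ^ (N + 1) * f = g ^ (N + 1) := by
    intro f hf
    rw [add_assoc, pow_add x n (N + 1), pow_add g n (N + 1), mul_inv_rev] at hf
    have : x ^ n * (f * (g ^ n)⁻¹) = x ^ n * ((x ^ (N + 1) * f * (g ^ (N + 1))⁻¹) * (g ^ n)⁻¹) := by
      simpa only [mul_assoc] using hf
    have := mul_right_cancel (mul_left_cancel this)
    have h3 := eq_mul_inv_iff_mul_eq.1 this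
    rw [mul_assoc, ← h3, inv_mul_cancel_left]
  have k1 := key f1 hF.1
  have k2 := key f2 hF.2
  have hxN : x ^ (N + 1) ≠ 1 := by
    intro h; exact hx ((pow_eq_one_iff_left (by omega)).1 h)
  refine free_comm_trans (x ^ (N + 1)) x (f1 * f2⁻¹) hxN (by rw [← pow_succ, ← pow_succ']) ?_
  have k3 := k1.trans k2.symm
  have k4 : x ^ (N + 1) * f1 = f1 * (f2⁻¹ * x ^ (N + 1) * f2) := by
    rw [← k3]; group
  calc f1 * f2⁻¹ * x ^ (N + 1) = f1 * (f2⁻¹ * x ^ (N + 1) * f2) * f2⁻¹ := by group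
    _ = x ^ (N + 1) * f1 * f2⁻¹ := by rw [k4]
    _ = _ := by group

theorem core (a : Fin 4 → FreeGroup X) (ha : Subgroup.closure (Set.range a) = ⊤)
    (ι : Fin 3 → X) (hι : Function.Injective ι) (x y : FreeGroup X)
    (hx1 : x ∈ Subgroup.closure (a '' {0, 1})) (hx2 : x ∈ Subgroup.closure (a '' {2, 3}))
    (hy1 : y ∈ Subgroup.closure (a '' {0, 1})) (hy2 : y ∈ Subgroup.closure (a '' {2, 3})) :
    x * y = y * x := by
  by_cases hx : x = 1
  · simp [hx]
  by_cases hy : y = 1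
  · simp [hy]
  obtain ⟨m, hm, hm2⟩ := exists_m ℚ a ha ι hι
  obtain ⟨p, hp⟩ := hm2 x hx1 hx2
  obtain ⟨q, hq⟩ := hm2 y hy1 hy2
  have hm0 : m ≠ 0 := by
    rintro rfl
    rw [zero_mul] at hp
    have := sub_eq_zero.1 hp.symm
    rw [← gs_one] at this
    exact hx (MonoidAlgebra.single_left_injective one_ne_zero this)
  obtain ⟨f1, hf1⟩ : ∃ f, m.coeff f ≠ 0 := by
    by_contra hcon
    push Not at hcon
    apply hm0
    rw [← MonoidAlgebra.coeff_inj]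
    ext f; simpa using hcon f
  obtain ⟨f2, hf2, hne⟩ : ∃ f, m.coeff f ≠ 0 ∧ f ≠ f1 := by
    by_contra hcon
    push Not at hcon
    have : m = MonoidAlgebra.single f1 (m.coeff f1) := by
      rw [← MonoidAlgebra.coeff_inj, MonoidAlgebra.coeff_single]
      classical
      ext f
      rw [Finsupp.single_apply]
      split_ifs with h
      · rw [h]
      · by_contra h'
        exact h (hcon f h').symm
    rw [this] at hm
    simp [aug] at hm
    exact hf1 hm
  have c1 := end_comm m p x hx hp f1 f2 hf1 hf2
  have c2 := end_comm m q y hy hq f1 f2 hf1 hf2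
  exact free_comm_trans (f1 * f2⁻¹) x y (fun h => hne (mul_inv_eq_one.1 h).symm) c1 c2

end conc
end JoinRank


namespace JoinRank

theorem rank_le {Γ : Type*} [Group Γ] {H : Subgroup Γ} {n : ℕ} (h : subgroupRank H ≤ (n : ℕ∞)) :
    ∃ S : Finset Γ, Subgroup.closure (S : Set Γ) = H ∧ S.card ≤ n := by
  by_contra hcon
  push Not at hcon
  have : ((n + 1 : ℕ) : ℕ∞) ≤ subgroupRank H :=
    le_iInf₂ fun S hS => by exact_mod_cast hcon S hS
  have := this.trans h
  norm_cast at this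
  omega

theorem rank_le_of {Γ : Type*} [Group Γ] {H : Subgroup Γ} {n : ℕ} (S : Finset Γ)
    (h : Subgroup.closure (S : Set Γ) = H) (hS : S.card ≤ n) : subgroupRank H ≤ (n : ℕ∞) :=
  (iInf₂_le S h).trans (by exact_mod_cast hS)

theorem localRank_le {Γ : Type*} [Group Γ] {H : Subgroup Γ} {n : ℕ} (h : localRank H ≤ (n : ℕ∞)) :
    LocalRankLE H n := by
  by_contra hcon
  have : ((n + 1 : ℕ) : ℕ∞) ≤ localRank H := by
    refine le_iInf₂ fun r hr => ?_
    have : n < r := by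
      by_contra hlt
      apply hcon
      intro B hB hfg
      obtain ⟨C, h1, h2, h3⟩ := hr B hB hfg
      exact ⟨C, h1, h2, h3.trans (by exact_mod_cast not_lt.1 hlt)⟩
    exact_mod_cast this
  have := this.trans h
  norm_cast at this
  omega

theorem pair_of_rank {Γ : Type*} [Group Γ] {H : Subgroup Γ} (h : subgroupRank H ≤ ((2 : ℕ) : ℕ∞)) :
    ∃ a b : Γ, H = Subgroup.closure {a, b} := by
  classical
  obtain ⟨S, hS, hc⟩ := rank_le h
  have : S.card = 0 ∨ S.card = 1 ∨ S.card = 2 := by omega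
  rcases this with h | h | h
  · rw [Finset.card_eq_zero] at h
    subst h
    exact ⟨1, 1, by rw [← hS, Set.pair_eq_singleton, Subgroup.closure_singleton_one]; simp⟩
  · obtain ⟨a, rfl⟩ := Finset.card_eq_one.1 h
    exact ⟨a, a, by rw [← hS]; simp⟩
  · obtain ⟨a, b, _, rfl⟩ := Finset.card_eq_two.1 h
    exact ⟨a, b, by rw [← hS]; simp⟩

theorem join_rank {Γ : Type*} [Group Γ] (h4 : KFree Γ 4) (g : Fin 4 → Γ) (x y : Γ)
    (hx1 : x ∈ Subgroup.closure (g '' {0, 1})) (hx2 : x ∈ Subgroup.closure (g '' {2, 3}))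
    (hy1 : y ∈ Subgroup.closure (g '' {0, 1})) (hy2 : y ∈ Subgroup.closure (g '' {2, 3}))
    (hxy : x * y ≠ y * x) : subgroupRank (Subgroup.closure (Set.range g)) ≤ ((2 : ℕ) : ℕ∞) := by
  classical
  set F := Subgroup.closure (Set.range g) with hF
  have hfree : IsFreeGroup F := by
    apply h4
    refine rank_le_of (Finset.univ.image g) (by simp [hF]) ?_
    exact Finset.card_image_le.trans (by simp)
  let Y := IsFreeGroup.Generators F
  let e : F ≃* FreeGroup Y := IsFreeGroup.toFreeGroup F
  have hgF : ∀ j, g j ∈ F := fun j => Subgroup.subset_closure ⟨j, rfl⟩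
  let a : Fin 4 → FreeGroup Y := fun j => e ⟨g j, hgF j⟩
  have hJF : ∀ J : Set (Fin 4), Subgroup.closure (g '' J) ≤ F := fun J =>
    Subgroup.closure_mono (Set.image_subset_range _ _)
  have key : ∀ J : Set (Fin 4), ∀ x ∈ Subgroup.closure (g '' J), ∀ hx : x ∈ F,
      e ⟨x, hx⟩ ∈ Subgroup.closure (a '' J) := by
    intro J x hx
    induction hx using Subgroup.closure_induction with
    | mem x hx =>
      obtain ⟨j, hj, rfl⟩ := hx
      intro _
      exact Subgroup.subset_closure ⟨j, hj, rfl⟩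
    | one => intro h; exact (map_one e).symm ▸ one_mem _
    | mul x y hx hy h1 h2 =>
      intro _
      have := mul_mem (h1 (hJF J hx)) (h2 (hJF J hy))
      rwa [← map_mul] at this
    | inv x hx h1 =>
      intro _
      have := inv_mem (h1 (hJF J hx))
      rwa [← map_inv] at this
  have ha : Subgroup.closure (Set.range a) = ⊤ := by
    rw [eq_top_iff]
    intro z _
    obtain ⟨⟨z, hz⟩, rfl⟩ := e.surjective z
    rw [← Set.image_univ]
    exact key _ z (by rw [Set.image_univ]; exact hz) hz
  have hfin : Finite Y := by
    by_contra hinf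
    rw [not_finite_iff_infinite] at hinf
    have := gens_card (fun j : Fin 5 => Infinite.natEmbedding Y j)
      (fun i j h => Fin.ext ((Infinite.natEmbedding Y).injective h)) a ha
    omega
  haveI : Fintype Y := Fintype.ofFinite Y
  have hcard : Fintype.card Y ≤ 2 := by
    by_contra hc
    have : Nonempty (Fin 3 ↪ Y) := by
      rw [Function.Embedding.nonempty_iff_card_le, Fintype.card_fin]
      omega
    obtain ⟨ι⟩ := this
    have hc := core a ha ι ι.injective (e ⟨x, hJF _ hx1⟩) (e ⟨y, hJF _ hy1⟩)
      (key _ x hx1 _) (key _ x hx2 _) (key _ y hy1 _) (key _ y hy2 _)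
    rw [← map_mul, ← map_mul] at hc
    exact hxy (congrArg Subtype.val (e.injective hc))
  refine rank_le_of (Finset.univ.image fun i : Y => ((e.symm (FreeGroup.of i) : F) : Γ)) ?_
    (Finset.card_image_le.trans (by simpa using hcard))
  have h1 : (⊤ : Subgroup (FreeGroup Y)).map (F.subtype.comp e.symm.toMonoidHom) = F := by
    rw [← Subgroup.map_map, Subgroup.map_top_of_surjective _ e.symm.surjective,
      ← MonoidHom.range_eq_map, Subgroup.range_subtype]
  rw [← FreeGroup.closure_range_of, MonoidHom.map_closure] at h1
  rw [← Set.range_comp] at h1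
  refine Eq.trans ?_ h1
  rw [Finset.coe_image, Finset.coe_univ, Set.image_univ]
  rfl

theorem join_fg {Γ : Type*} [Group Γ] (A B : Subgroup Γ) (S : Finset Γ)
    (hS : ∀ s ∈ S, s ∈ A ⊔ B) :
    ∃ SA SB : Finset Γ, (∀ s ∈ SA, s ∈ A) ∧ (∀ s ∈ SB, s ∈ B) ∧
      ∀ s ∈ S, s ∈ Subgroup.closure (SA : Set Γ) ⊔ Subgroup.closure (SB : Set Γ) := by
  classical
  have mono : ∀ SA SB TA TB : Finset Γ, SA ⊆ TA → SB ⊆ TB →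
      Subgroup.closure (SA : Set Γ) ⊔ Subgroup.closure (SB : Set Γ) ≤
      Subgroup.closure (TA : Set Γ) ⊔ Subgroup.closure (TB : Set Γ) := by
    intro SA SB TA TB h1 h2
    exact sup_le_sup (Subgroup.closure_mono (by exact_mod_cast h1))
      (Subgroup.closure_mono (by exact_mod_cast h2))
  have one : ∀ s ∈ A ⊔ B, ∃ SA SB : Finset Γ, (∀ s ∈ SA, s ∈ A) ∧ (∀ s ∈ SB, s ∈ B) ∧
      s ∈ Subgroup.closure (SA : Set Γ) ⊔ Subgroup.closure (SB : Set Γ) := by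
    intro s hs
    rw [Subgroup.sup_eq_closure] at hs
    induction hs using Subgroup.closure_induction with
    | mem x hx =>
      rcases hx with hx | hx
      · refine ⟨{x}, ∅, by simpa using hx, by simp, Subgroup.mem_sup_left ?_⟩
        exact Subgroup.subset_closure (by simp)
      · refine ⟨∅, {x}, by simp, by simpa using hx, Subgroup.mem_sup_right ?_⟩
        exact Subgroup.subset_closure (by simp)
    | one => exact ⟨∅, ∅, by simp, by simp, one_mem _⟩
    | mul x y _ _ h1 h2 =>
      obtain ⟨SA, SB, a1, a2, a3⟩ := h1
      obtain ⟨TA, TB, b1, b2, b3⟩ := h2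
      refine ⟨SA ∪ TA, SB ∪ TB, ?_, ?_, ?_⟩
      · intro s hs; rcases Finset.mem_union.1 hs with h | h
        exacts [a1 s h, b1 s h]
      · intro s hs; rcases Finset.mem_union.1 hs with h | h
        exacts [a2 s h, b2 s h]
      · exact mul_mem (mono _ _ _ _ Finset.subset_union_left Finset.subset_union_left a3)
          (mono _ _ _ _ Finset.subset_union_right Finset.subset_union_right b3)
    | inv x _ h1 =>
      obtain ⟨SA, SB, a1, a2, a3⟩ := h1
      exact ⟨SA, SB, a1, a2, inv_mem a3⟩
  induction S using Finset.induction_on with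
  | empty => exact ⟨∅, ∅, by simp, by simp, by simp⟩
  | insert x S hx ih =>
    obtain ⟨SA, SB, a1, a2, a3⟩ := ih (fun s hs => hS s (Finset.mem_insert_of_mem hs))
    obtain ⟨TA, TB, b1, b2, b3⟩ := one x (hS x (Finset.mem_insert_self _ _))
    refine ⟨SA ∪ TA, SB ∪ TB, ?_, ?_, ?_⟩
    · intro s hs; rcases Finset.mem_union.1 hs with h | h
      exacts [a1 s h, b1 s h]
    · intro s hs; rcases Finset.mem_union.1 hs with h | h
      exacts [a2 s h, b2 s h]
    · intro s hs
      rcases Finset.mem_insert.1 hs with rfl | h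
      · exact mono _ _ _ _ Finset.subset_union_right Finset.subset_union_right b3
      · exact mono _ _ _ _ Finset.subset_union_left Finset.subset_union_left (a3 s h)

theorem enlarge {Γ : Type*} [Group Γ] (A : Subgroup Γ) (hA : localRank A = 2) (S : Finset Γ)
    (hS : ∀ s ∈ S, s ∈ A) : ∃ a b : Γ, Subgroup.closure {a, b} ≤ A ∧
      ∀ s ∈ S, s ∈ Subgroup.closure {a, b} := by
  obtain ⟨C, h1, h2, h3⟩ := localRank_le (n := 2) (le_of_eq hA) (Subgroup.closure (S : Set Γ))
    ((Subgroup.closure_le A).2 hS) ⟨S, rfl⟩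
  obtain ⟨a, b, rfl⟩ := pair_of_rank h3
  exact ⟨a, b, h1, fun s hs => h2 (Subgroup.subset_closure hs)⟩

end JoinRank

/-- (Kent, Louder–McReynolds, generalized.) If `A` and `B` are subgroups of a `4`-free
group `Γ` with `localRank A = localRank B = 2` and `A ∩ B` non-abelian, then
`localRank ⟨A, B⟩ = 2`. -/
theorem localRank_join_eq_two {Γ : Type*} [Group Γ] (h4 : KFree Γ 4)
    (A B : Subgroup Γ) (hA : localRank A = 2) (hB : localRank B = 2)
    (hnab : ∃ x ∈ A ⊓ B, ∃ y ∈ A ⊓ B, x * y ≠ y * x) :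
    localRank (A ⊔ B) = 2 := by
  classical
  obtain ⟨x, hx, y, hy, hxy⟩ := hnab
  apply le_antisymm
  · refine iInf₂_le (2 : ℕ) ?_
    rintro D hD ⟨S, rfl⟩
    obtain ⟨SA, SB, h1, h2, h3⟩ := JoinRank.join_fg A B S
      (fun s hs => hD (Subgroup.subset_closure hs))
    obtain ⟨a, b, ha1, ha2⟩ := JoinRank.enlarge A hA (insert x (insert y SA)) (by
      intro s hs
      rw [Finset.mem_insert, Finset.mem_insert] at hs
      rcases hs with rfl | rfl | hs
      exacts [hx.1, hy.1, h1 s hs])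
    obtain ⟨c, d, hb1, hb2⟩ := JoinRank.enlarge B hB (insert x (insert y SB)) (by
      intro s hs
      rw [Finset.mem_insert, Finset.mem_insert] at hs
      rcases hs with rfl | rfl | hs
      exacts [hx.2, hy.2, h2 s hs])
    have e1 : (![a, b, c, d] : Fin 4 → Γ) '' {0, 1} = {a, b} := by simp [Set.image_pair]
    have e2 : (![a, b, c, d] : Fin 4 → Γ) '' {2, 3} = {c, d} := by simp [Set.image_pair]
    have e3 : Set.range (![a, b, c, d] : Fin 4 → Γ) = {a, b} ∪ {c, d} := by
      rw [← e1, ← e2, ← Set.image_union, ← Set.image_univ]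
      congr 1
      ext j
      fin_cases j <;> simp
    have hr := JoinRank.join_rank h4 ![a, b, c, d] x y
      (by rw [e1]; exact ha2 x (by simp)) (by rw [e2]; exact hb2 x (by simp))
      (by rw [e1]; exact ha2 y (by simp)) (by rw [e2]; exact hb2 y (by simp)) hxy
    rw [e3, Subgroup.closure_union] at hr
    refine ⟨_, sup_le_sup ha1 hb1, ?_, hr⟩
    rw [Subgroup.closure_le]
    intro s hs
    have hle : Subgroup.closure (SA : Set Γ) ⊔ Subgroup.closure (SB : Set Γ) ≤
        Subgroup.closure {a, b} ⊔ Subgroup.closure {c, d} := by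
      refine sup_le_sup ?_ ?_
      · rw [Subgroup.closure_le]
        intro t ht
        exact ha2 t (by simp [Finset.mem_coe.1 ht])
      · rw [Subgroup.closure_le]
        intro t ht
        exact hb2 t (by simp [Finset.mem_coe.1 ht])
    exact hle (h3 s hs)
  · refine le_iInf₂ fun r hr => ?_
    by_contra hlt
    have hr1 : r ≤ 1 := by
      by_contra h
      apply hlt
      have : 2 ≤ r := by omega
      exact_mod_cast this
    obtain ⟨C, h1, h2, h3⟩ := hr (Subgroup.closure {x, y}) (by
      rw [Subgroup.closure_le]
      rintro s (rfl | rfl)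
      · exact Subgroup.mem_sup_left hx.1
      · exact Subgroup.mem_sup_left hy.1) ⟨{x, y}, by simp⟩
    obtain ⟨S, rfl, hS⟩ := JoinRank.rank_le h3
    have hxC := h2 (Subgroup.subset_closure (by simp : x ∈ ({x, y} : Set Γ)))
    have hyC := h2 (Subgroup.subset_closure (by simp : y ∈ ({x, y} : Set Γ)))
    obtain ⟨t, ht⟩ : ∃ t : Γ, (S : Set Γ) ⊆ {t} := by
      have := Finset.card_le_one_iff_subset_singleton.1 (hS.trans hr1)
      obtain ⟨t, ht⟩ := this
      exact ⟨t, by exact_mod_cast ht⟩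
    have hxt := Subgroup.closure_mono ht hxC
    have hyt := Subgroup.closure_mono ht hyC
    rw [Subgroup.mem_closure_singleton] at hxt hyt
    obtain ⟨n, rfl⟩ := hxt
    obtain ⟨m, rfl⟩ := hyt
    apply hxy
    rw [← zpow_add, ← zpow_add, add_comm]
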